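/- arXiv:2409.02388 — 2 statements merged into one kernel-verified Lean document; each statement's English description precedes it below -/
import Mathlib

section
/- Let p_X be the Gaussian distribution N(μ_X, σ_X²) with σ_X > 0, and let p_X̂ be a probability measure on ℝ with finite second moment, mean μ_X̂, and standard deviation σ_X̂ > 0. Let p_X̂G denote the Gaussian distribution N(μ_X̂, σ_X̂²). Then W₂²(p_X, p_X̂) − W₂²(p_X, p_X̂G) ≤ 2 σ_X σ_X̂ (1 − e^{−(φ_KL(p_X̂‖p_X) − φ_KL(p_X̂G‖p_X))}). -/
open MeasureTheory ProbabilityTheory Real Set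
open scoped ENNReal NNReal

noncomputable section

open Classical in
/-- Kullback-Leibler divergence of `q` from `p`, in `[0,∞]`. -/
def KLD {α : Type*} [MeasurableSpace α] (q p : Measure α) : ℝ≥0∞ :=
  if q ≪ p ∧ Integrable (fun x => Real.log (q.rnDeriv p x).toReal) q
  then ENNReal.ofReal (∫ x, Real.log (q.rnDeriv p x).toReal ∂q) else ⊤

/-- Mutual information between `f` and `g` under `μ`. -/
def mutInfo {Ω α β : Type*} [MeasurableSpace Ω] [MeasurableSpace α] [MeasurableSpace β]
    (μ : Measure Ω) (f : Ω → α) (g : Ω → β) : ℝ≥0∞ :=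
  KLD (μ.map (fun ω => (f ω, g ω))) ((μ.map f).prod (μ.map g))

/-- Squared Wasserstein-2 distance. -/
def W2sq (p q : Measure ℝ) : ℝ≥0∞ :=
  ⨅ (cpl : Measure (ℝ × ℝ)) (_ : IsProbabilityMeasure cpl) (_ : cpl.map Prod.fst = p)
    (_ : cpl.map Prod.snd = q), ∫⁻ xy, ENNReal.ofReal ((xy.1 - xy.2) ^ 2) ∂cpl

/-- `exp(-x)` for `x ∈ [0,∞]`, with `exp(-∞) = 0`. -/
def expNeg (x : ℝ≥0∞) : ℝ := if x = ⊤ then 0 else Real.exp (-x.toReal)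

/-- Feasibility predicate for the distortion-rate-perception function. -/
def DRPfeasible (pX : Measure ℝ) (φ : Measure ℝ → Measure ℝ → ℝ≥0∞) (R Rc P : ℝ≥0∞)
    (μ : Measure (ℝ × ℝ × ℝ)) : Prop :=
  ∃ hμ : IsProbabilityMeasure μ,
    μ.map (fun w => w.1) = pX ∧
    (haveI := hμ
     CondIndepFun (MeasurableSpace.comap (fun w : ℝ × ℝ × ℝ => w.2.1) inferInstance)
      ((measurable_fst.comp measurable_snd).comap_le)
      (fun w : ℝ × ℝ × ℝ => w.1) (fun w : ℝ × ℝ × ℝ => w.2.2) μ) ∧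
    mutInfo μ (fun w => w.1) (fun w => w.2.1) ≤ R ∧
    mutInfo μ (fun w => w.2.2) (fun w => w.2.1) ≤ R + Rc ∧
    φ pX (μ.map (fun w => w.2.2)) ≤ P

/-- Mean squared distortion of a joint law of `(X, U, X̂)`. -/
def distortion (μ : Measure (ℝ × ℝ × ℝ)) : ℝ≥0∞ :=
  ∫⁻ w, ENNReal.ofReal ((w.1 - w.2.2) ^ 2) ∂μ

/-- The distortion-rate-perception function `D(R, R_c, P | φ)`. -/
def DRP (pX : Measure ℝ) (φ : Measure ℝ → Measure ℝ → ℝ≥0∞) (R Rc P : ℝ≥0∞) : ℝ≥0∞ :=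
  ⨅ (μ : Measure (ℝ × ℝ × ℝ)) (_ : DRPfeasible pX φ R Rc P μ), distortion μ

/-- `D(R, R_c, ∞)`: the DRP function without perception constraint. -/
def DRPinf (pX : Measure ℝ) (R Rc : ℝ≥0∞) : ℝ≥0∞ :=
  DRP pX (fun _ _ => 0) R Rc ⊤

/-- Deterministic-decoder (entropy-constrained quantization) function `D_e(R, R_c)`,
with `H(X̂) := I(X̂; X̂)`. -/
def De (pX : Measure ℝ) (R Rc : ℝ≥0∞) : ℝ≥0∞ :=
  ⨅ (cpl : Measure (ℝ × ℝ)) (_ : IsProbabilityMeasure cpl ∧ cpl.map Prod.fst = pX ∧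
      mutInfo cpl Prod.fst Prod.snd ≤ R ∧ mutInfo cpl Prod.snd Prod.snd ≤ R + Rc),
    ∫⁻ w, ENNReal.ofReal ((w.1 - w.2) ^ 2) ∂cpl

/-- The Gaussian measure `N(μ, σ²)`. -/
def gauss (μ σ : ℝ) : Measure ℝ := gaussianReal μ ⟨σ ^ 2, sq_nonneg σ⟩

end
noncomputable section

/-- `ξ(R, R_c) = √((1 - e^{-2R})(1 - e^{-2(R+R_c)}))`. -/
def xiRRc (R Rc : ℝ≥0∞) : ℝ :=
  Real.sqrt ((1 - expNeg (2 * R)) * (1 - expNeg (2 * (R + Rc))))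

/-- `ψ(σ) = log(σ_X/σ) + (σ² - σ_X²)/(2σ_X²)`. -/
def psi (σX s : ℝ) : ℝ := Real.log (σX / s) + (s ^ 2 - σX ^ 2) / (2 * σX ^ 2)

/-- `δ₊(σ̂, α)` from the improved lower bound. -/
def deltaPlus (σX : ℝ) (R Rc : ℝ≥0∞) (P s α : ℝ) : ℝ :=
  max (σX * expNeg (R + Rc) -
    Real.sqrt (σX ^ 2 - α * (σX ^ 2 + s ^ 2 - P) + α ^ 2 * s ^ 2)) 0 / α

/-- The inner `sup` over `α > 0` in the improved lower bound `D̲'`. -/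
def DlowerPrimeFun (σX : ℝ) (R Rc : ℝ≥0∞) (P s : ℝ) : ℝ :=
  sSup ((fun α => σX ^ 2 + s ^ 2 - 2 * σX *
    Real.sqrt ((1 - expNeg (2 * R)) * (s ^ 2 - deltaPlus σX R Rc P s α ^ 2))) '' Set.Ioi 0)

/-- The improved explicit lower bound `D̲'(R, R_c, P | W₂²)`. -/
def DlowerPrime (σX : ℝ) (R Rc : ℝ≥0∞) (P : ℝ) : ℝ :=
  sInf (DlowerPrimeFun σX R Rc P '' Set.Icc (max (σX - Real.sqrt P) 0) σX)

/-- The explicit lower bound `D̲(R, R_c, P | W₂²)` of Xie et al. -/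
def DlowerW2 (σX : ℝ) (R Rc : ℝ≥0∞) (P : ℝ) : ℝ :=
  sInf ((fun s => σX ^ 2 + s ^ 2 - 2 * σX *
      Real.sqrt ((1 - expNeg (2 * R)) *
        (s ^ 2 - max (σX * expNeg (R + Rc) - Real.sqrt P) 0 ^ 2)))
    '' Set.Icc (max (σX - Real.sqrt P) 0) σX)

end

lemma aux_cdf_cont (q : Measure ℝ) [IsProbabilityMeasure q] (hac : ∀ x, q {x} = 0) :
    Continuous (cdf q) := by
  rw [continuous_iff_continuousAt]
  intro x
  rw [(monotone_cdf q).continuousAt_iff_leftLim_eq_rightLim, StieltjesFunction.rightLim_eq]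
  apply le_antisymm ((monotone_cdf q).leftLim_le le_rfl)
  have h := (cdf q).measure_singleton x
  rw [measure_cdf, hac] at h
  have := ENNReal.ofReal_eq_zero.1 h.symm
  linarith

lemma aux_cdf_surj (q : Measure ℝ) [IsProbabilityMeasure q] (hac : ∀ x, q {x} = 0)
    (u : ℝ) (h0 : 0 < u) (h1 : u < 1) : ∃ t, cdf q t = u := by
  obtain ⟨a, ha⟩ := ((tendsto_cdf_atBot q).eventually (gt_mem_nhds h0)).exists
  obtain ⟨b, hb⟩ := ((tendsto_cdf_atTop q).eventually (lt_mem_nhds h1)).exists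
  exact mem_range_of_exists_le_of_exists_ge (aux_cdf_cont q hac) ⟨a, ha.le⟩ ⟨b, hb.le⟩

lemma aux_cdf_le (q : Measure ℝ) [IsProbabilityMeasure q] (hac : ∀ x, q {x} = 0)
    (u : ℝ) (h0 : 0 < u) (h1 : u < 1) : q {y | cdf q y ≤ u} = ENNReal.ofReal u := by
  apply le_antisymm
  · -- upper bound: for all v > u
    have key : ∀ v, u < v → v < 1 → q {y | cdf q y ≤ u} ≤ ENNReal.ofReal v := by
      intro v hv hv1
      obtain ⟨t, ht⟩ := aux_cdf_surj q hac v (h0.trans hv) hv1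
      rw [← ht, ofReal_cdf]
      apply measure_mono
      intro y hy
      simp only [mem_ofPred_eq] at hy
      by_contra hty
      have := monotone_cdf q (not_le.1 hty).le
      linarith
    have hc : Filter.Tendsto ENNReal.ofReal (nhdsWithin u (Ioi u)) (nhds (ENNReal.ofReal u)) :=
      (ENNReal.continuous_ofReal.tendsto u).mono_left nhdsWithin_le_nhds
    refine ge_of_tendsto hc ?_
    filter_upwards [Ioo_mem_nhdsGT h1] with v hv using key v hv.1 hv.2
  · obtain ⟨t, ht⟩ := aux_cdf_surj q hac u h0 h1
    rw [← ht, ofReal_cdf]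
    apply measure_mono
    intro y hy
    exact monotone_cdf q hy

lemma aux_cdf_mem (q : Measure ℝ) [IsProbabilityMeasure q] (hac : ∀ x, q {x} = 0) :
    ∀ᵐ y ∂q, 0 < cdf q y ∧ cdf q y < 1 := by
  have hmeas : Measurable (cdf q) := (monotone_cdf q).measurable
  have A : ∀ᵐ y ∂q, 0 < cdf q y := by
    rw [ae_iff]
    simp only [not_lt]
    refine le_antisymm ?_ zero_le
    have hc : Filter.Tendsto ENNReal.ofReal (nhdsWithin 0 (Ioi 0)) (nhds (ENNReal.ofReal 0)) :=
      (ENNReal.continuous_ofReal.tendsto 0).mono_left nhdsWithin_le_nhds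
    rw [ENNReal.ofReal_zero] at hc
    refine ge_of_tendsto hc ?_
    filter_upwards [Ioo_mem_nhdsGT (zero_lt_one (α := ℝ))] with v hv
    rw [← aux_cdf_le q hac v hv.1 hv.2]
    exact measure_mono fun y hy => le_trans hy hv.1.le
  have B : ∀ᵐ y ∂q, cdf q y < 1 := by
    rw [ae_iff]
    simp only [not_lt]
    refine le_antisymm ?_ zero_le
    have hc : Filter.Tendsto (fun v => 1 - ENNReal.ofReal v) (nhdsWithin 1 (Iio 1))
        (nhds (1 - ENNReal.ofReal 1)) :=
      (((ENNReal.continuous_sub_left ENNReal.one_ne_top).comp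
        ENNReal.continuous_ofReal).tendsto 1).mono_left nhdsWithin_le_nhds
    rw [ENNReal.ofReal_one, tsub_self] at hc
    refine ge_of_tendsto hc ?_
    filter_upwards [Ioo_mem_nhdsLT (zero_lt_one (α := ℝ))] with v hv
    rw [← aux_cdf_le q hac v hv.1 hv.2, ← prob_compl_eq_one_sub (measurableSet_le hmeas measurable_const)]
    apply measure_mono
    intro y hy
    simp only [mem_compl_iff, mem_ofPred_eq, not_le] at hy ⊢
    linarith [hv.2]
  filter_upwards [A, B] with y h1 h2 using ⟨h1, h2⟩

lemma aux_transport (q γ : Measure ℝ) [IsProbabilityMeasure q] [IsProbabilityMeasure γ]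
    (hac : ∀ x, q {x} = 0) (hγ : ∀ x, γ {x} = 0) (hinj : StrictMono (cdf γ))  :
    ∃ s : ℝ → ℝ, Measurable s ∧ q.map s = γ ∧
      (∀ t, 0 < cdf q t → cdf q t < 1 →
        (Ioi t : Set ℝ) =ᵐ[q] s ⁻¹' (Ioi (s t))) := by
  have hΦ : MeasurableEmbedding (cdf γ) :=
    (aux_cdf_cont γ hγ).measurableEmbedding hinj.injective
  have hqm : Measurable (cdf q) := (monotone_cdf q).measurable
  let Ψ : ℝ → ℝ := Function.extend (cdf γ) id (fun _ => 0)
  have hΨm : Measurable Ψ := hΦ.measurable_extend measurable_id measurable_const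
  let s : ℝ → ℝ := fun y => Ψ (cdf q y)
  have hs : ∀ t, 0 < cdf q t → cdf q t < 1 → cdf γ (s t) = cdf q t := by
    intro t h0 h1
    obtain ⟨z, hz⟩ := aux_cdf_surj γ hγ _ h0 h1
    have : s t = z := by
      simp only [s, Ψ]
      rw [← hz, hinj.injective.extend_apply]; rfl
    rw [this, hz]
  have hΦ0 : ∀ z, 0 < cdf γ z := fun z =>
    lt_of_le_of_lt (cdf_nonneg γ (z-1)) (hinj (by linarith))
  have hΦ1 : ∀ z, cdf γ z < 1 := fun z =>
    lt_of_lt_of_le (hinj (by linarith : z < z + 1)) (cdf_le_one γ (z+1))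
  have hsm : Measurable s := hΨm.comp hqm
  have hmem := aux_cdf_mem q hac
  refine ⟨s, hsm, ?_, ?_⟩
  · have : IsProbabilityMeasure (q.map s) := Measure.isProbabilityMeasure_map hsm.aemeasurable
    refine Measure.ext_of_Iic _ _ fun z => ?_
    rw [Measure.map_apply hsm measurableSet_Iic, ← ofReal_cdf γ, ← aux_cdf_le q hac _ (hΦ0 z) (hΦ1 z)]
    apply measure_congr
    filter_upwards [hmem] with y hy
    apply propext
    change s y ≤ z ↔ cdf q y ≤ cdf γ z
    rw [← hs y hy.1 hy.2, hinj.le_iff_le]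
  · intro t h0 h1
    have h2 : (Iic t : Set ℝ) =ᵐ[q] {y | cdf q y ≤ cdf q t} := by
      refine ae_eq_of_subset_of_measure_ge (fun y hy => monotone_cdf q hy) ?_
        measurableSet_Iic.nullMeasurableSet (measure_ne_top _ _)
      rw [aux_cdf_le q hac _ h0 h1, ofReal_cdf]
    have h3 := h2.compl
    rw [compl_Iic] at h3
    refine h3.trans ?_
    filter_upwards [hmem] with y hy
    apply propext
    change ¬ (cdf q y ≤ cdf q t) ↔ s t < s y
    rw [← hs y hy.1 hy.2, ← hs t h0 h1, hinj.le_iff_le, not_le]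

lemma aux_gauss_null (x : ℝ) : gaussianReal 0 1 {x} = 0 :=
  gaussianReal_absolutelyContinuous 0 one_ne_zero (by simp)

lemma aux_gauss_strictMono : StrictMono (cdf (gaussianReal 0 1)) := by
  intro a b hab
  have hpos : (gaussianReal 0 1) (Ioc a b) ≠ 0 := by
    intro h
    have := gaussianReal_absolutelyContinuous' 0 (one_ne_zero (α := ℝ≥0)) h
    rw [Real.volume_Ioc] at this
    have := ENNReal.ofReal_eq_zero.1 this
    linarith
  rw [← measure_cdf (gaussianReal 0 1), StieltjesFunction.measure_Ioc] at hpos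
  by_contra hcon
  exact hpos (ENNReal.ofReal_eq_zero.2 (by linarith))

lemma aux_gauss_tail (a : ℝ) :
    ∫ z in Ioi a, z ∂(gaussianReal 0 1) = gaussianPDFReal 0 1 a := by
  have hd : ∀ z : ℝ, HasDerivAt (fun z => - gaussianPDFReal 0 1 z)
      (gaussianPDFReal 0 1 z * z) z := by
    intro z
    simp only [gaussianPDFReal_def]
    have h1 : HasDerivAt (fun z : ℝ => -(z - 0)^2 / (2 * ((1:ℝ≥0):ℝ))) (-z) z := by
      have := (((hasDerivAt_id z).sub_const 0).pow 2).neg.div_const (2 * ((1:ℝ≥0):ℝ))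
      exact this.congr_deriv (by simp; ring)
    have := (h1.exp.const_mul ((√(2 * π * ((1:ℝ≥0):ℝ)))⁻¹)).neg
    exact this.congr_deriv (by ring)
  have hint : Integrable (fun z : ℝ => gaussianPDFReal 0 1 z * z) := by
    have h := (memLp_id_gaussianReal (μ := 0) (v := 1) 1).integrable (by simp)
    rw [gaussianReal_of_var_ne_zero _ one_ne_zero,
      integrable_withDensity_iff (measurable_gaussianPDF _ _)
        (Filter.Eventually.of_forall fun x => gaussianPDF_lt_top)] at h
    refine h.congr (Filter.Eventually.of_forall fun x => ?_)
    simp [mul_comm]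
  have ht : Filter.Tendsto (fun z => - gaussianPDFReal 0 1 z) Filter.atTop (nhds 0) := by
    simp only [gaussianPDFReal_def]
    have : Filter.Tendsto (fun z : ℝ => -(z-0)^2 / (2 * ((1:ℝ≥0):ℝ))) Filter.atTop Filter.atBot := by
      simp only [sub_zero, NNReal.coe_one, mul_one, neg_div]
      apply Filter.tendsto_neg_atTop_atBot.comp
      exact (Filter.tendsto_pow_atTop two_ne_zero).atTop_div_const (by norm_num)
    have := ((Real.tendsto_exp_atBot.comp this).const_mul ((√(2 * π * ((1:ℝ≥0):ℝ)))⁻¹)).neg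
    simpa using this
  have key := integral_Ioi_of_hasDerivAt_of_tendsto' (a := a) (fun z _ => hd z)
    hint.integrableOn ht
  rw [gaussianReal_of_var_ne_zero _ one_ne_zero,
    setIntegral_withDensity_eq_setIntegral_toReal_smul (measurable_gaussianPDF _ _)
      (Filter.Eventually.of_forall fun x => gaussianPDF_lt_top) _ measurableSet_Ioi]
  simp only [toReal_gaussianPDF, smul_eq_mul]
  rw [key]; ring

/-- the layer-cake kernel -/
lemma aux_kernel (y : ℝ) :
    Integrable (fun t : ℝ => (Ioi t).indicator (fun _ => (1:ℝ)) y - (Iio 0).indicator (fun _ => 1) t)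
    ∧ (∫ t : ℝ, ((Ioi t).indicator (fun _ => (1:ℝ)) y - (Iio 0).indicator (fun _ => 1) t)) = y
    ∧ (∫ t : ℝ, ‖(Ioi t).indicator (fun _ => (1:ℝ)) y - (Iio 0).indicator (fun _ => 1) t‖) = |y| := by
  rcases le_total 0 y with hy | hy
  · have h : (fun t : ℝ => (Ioi t).indicator (fun _ => (1:ℝ)) y - (Iio 0).indicator (fun _ => 1) t)
        = (Ico 0 y).indicator (fun _ => 1) := by
      funext t
      simp only [indicator_apply, mem_Ioi, mem_Iio, mem_Ico]
      grind
    have h' : ∀ t : ℝ, (Ioi t).indicator (fun _ => (1:ℝ)) y - (Iio 0).indicator (fun _ => 1) t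
        = (Ico 0 y).indicator (fun _ => 1) t := fun t => congrFun h t
    have h2 : ∀ t : ℝ, ‖(Ico 0 y).indicator (fun _ => (1:ℝ)) t‖ = (Ico 0 y).indicator (fun _ => 1) t := by
      intro t; simp only [indicator_apply]; split_ifs <;> simp
    refine ⟨?_, ?_, ?_⟩
    · rw [h]; exact (integrable_indicator_iff measurableSet_Ico).2 (by simp)
    · simp_rw [h']; rw [integral_indicator measurableSet_Ico]; simp [hy]
    · simp_rw [h', h2]; rw [integral_indicator measurableSet_Ico]; simp [hy, abs_of_nonneg hy]
  · have h : (fun t : ℝ => (Ioi t).indicator (fun _ => (1:ℝ)) y - (Iio 0).indicator (fun _ => 1) t)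
        = (Ico y 0).indicator (fun _ => -1) := by
      funext t
      simp only [indicator_apply, mem_Ioi, mem_Iio, mem_Ico]
      grind
    have h' : ∀ t : ℝ, (Ioi t).indicator (fun _ => (1:ℝ)) y - (Iio 0).indicator (fun _ => 1) t
        = (Ico y 0).indicator (fun _ => -1) t := fun t => congrFun h t
    have h2 : ∀ t : ℝ, ‖(Ico y 0).indicator (fun _ => (-1:ℝ)) t‖ = (Ico y 0).indicator (fun _ => 1) t := by
      intro t; simp only [indicator_apply]; split_ifs <;> simp
    refine ⟨?_, ?_, ?_⟩
    · rw [h]; exact (integrable_indicator_iff measurableSet_Ico).2 (by simp)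
    · simp_rw [h']; rw [integral_indicator measurableSet_Ico]; simp [hy]
    · simp_rw [h', h2]; rw [integral_indicator measurableSet_Ico]; simp [hy, abs_of_nonpos hy]

lemma aux_fubini (q : Measure ℝ) [IsProbabilityMeasure q] (s : ℝ → ℝ) (hs : Measurable s)
    (hsi : Integrable s q) (hys : Integrable (fun y => y * s y) q) (hs0 : ∫ y, s y ∂q = 0) :
    Integrable (fun t => ∫ y in Ioi t, s y ∂q) ∧
      ∫ t, (∫ y in Ioi t, s y ∂q) = ∫ y, y * s y ∂q := by
  let H : ℝ × ℝ → ℝ := fun w => s w.1 *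
    ((Ioi w.2).indicator (fun _ => (1:ℝ)) w.1 - (Iio 0).indicator (fun _ => 1) w.2)
  have hHm : Measurable H := by
    apply (hs.comp measurable_fst).mul
    apply Measurable.sub
    · have : (fun w : ℝ × ℝ => (Ioi w.2).indicator (fun _ => (1:ℝ)) w.1)
          = {w : ℝ × ℝ | w.2 < w.1}.indicator (fun _ => 1) := by
        funext w; simp [indicator_apply]
      rw [this]
      exact measurable_const.indicator (measurableSet_lt measurable_snd measurable_fst)
    · exact (measurable_const.indicator measurableSet_Iio).comp measurable_snd
  have hH : Integrable H (q.prod volume) := by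
    rw [integrable_prod_iff hHm.aestronglyMeasurable]
    constructor
    · refine Filter.Eventually.of_forall fun y => ?_
      exact (aux_kernel y).1.const_mul (s y)
    · simp only [H, norm_mul]
      simp_rw [integral_const_mul, (aux_kernel _).2.2]
      refine hys.norm.congr (Filter.Eventually.of_forall fun y => ?_)
      simp [mul_comm]
  have hg : ∀ t, ∫ y, H (y, t) ∂q = ∫ y in Ioi t, s y ∂q := by
    intro t
    have : ∀ y, H (y, t) = (Ioi t).indicator s y - (Iio 0).indicator (fun _ => (1:ℝ)) t * s y := by
      intro y
      simp only [H, indicator_apply]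
      split_ifs <;> ring
    simp_rw [this]
    rw [integral_sub (hsi.indicator measurableSet_Ioi) (hsi.const_mul _), integral_const_mul, hs0,
      integral_indicator measurableSet_Ioi]
    ring
  constructor
  · have := hH.integral_prod_right
    simpa only [hg] using this
  · have := integral_integral_swap (f := fun y t => H (y, t)) hH
    simp only [hg] at this
    rw [← this]
    apply integral_congr_ae
    refine Filter.Eventually.of_forall fun y => ?_
    simp only [H]
    rw [integral_const_mul, (aux_kernel y).2.1, mul_comm]

lemma aux_log_gauss (m : ℝ) (v : ℝ≥0) (hv : v ≠ 0) (x : ℝ) :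
    Real.log (gaussianPDFReal m v x) = - Real.log (√(2 * π * v)) - (x - m) ^ 2 / (2 * v) := by
  have hv' : 0 < (v : ℝ) := lt_of_le_of_ne v.2 (by exact_mod_cast hv.symm)
  have : 0 < √(2 * π * v) := Real.sqrt_pos.2 (by positivity)
  rw [gaussianPDFReal_def]
  simp only
  rw [Real.log_mul (by positivity) (by positivity), Real.log_exp, Real.log_inv]
  ring

lemma aux_gauss_sq (m : ℝ) (v : ℝ≥0) : Integrable (fun x => x ^ 2) (gaussianReal m v) ∧
    ∫ x, (x - m) ^ 2 ∂(gaussianReal m v) = v := by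
  constructor
  · have := (memLp_id_gaussianReal (μ := m) (v := v) 2).integrable_sq
    simpa using this
  · have := variance_fun_id_gaussianReal (μ := m) (v := v)
    rw [variance_eq_integral measurable_id'.aemeasurable] at this
    simpa using this

lemma aux_main (q : Measure ℝ) [IsProbabilityMeasure q] (hac : q ≪ volume)
    (hm2 : Integrable (fun x => x ^ 2) q)
    (hl : Integrable (fun x => Real.log (q.rnDeriv volume x).toReal) q) :
    ∃ s : ℝ → ℝ, Measurable s ∧ q.map s = gaussianReal 0 1 ∧
      Real.exp (- (∫ x, Real.log (q.rnDeriv volume x).toReal ∂q) - Real.log (√(2 * π)) - 1 / 2)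
        ≤ ∫ y, y * s y ∂q := by
  have hq0 : ∀ x, q {x} = 0 := fun x => hac (by simp)
  obtain ⟨s, hs, hmap, hset⟩ := aux_transport q (gaussianReal 0 1) hq0 aux_gauss_null
    aux_gauss_strictMono
  refine ⟨s, hs, hmap, ?_⟩
  have hs2 : Integrable (fun y => s y ^ 2) q := by
    have := (aux_gauss_sq 0 1).1
    rw [← hmap] at this
    exact this.comp_measurable hs
  have hs2i : ∫ y, s y ^ 2 ∂q = 1 := by
    have := (aux_gauss_sq 0 1).2
    rw [← hmap, integral_map hs.aemeasurable (by fun_prop)] at this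
    simpa using this
  have hsL : MemLp s 2 q := (memLp_two_iff_integrable_sq hs.aestronglyMeasurable).2 hs2
  have hyL : MemLp (fun y : ℝ => y) 2 q :=
    (memLp_two_iff_integrable_sq measurable_id.aestronglyMeasurable).2 hm2
  have hsi : Integrable s q := hsL.integrable (by norm_num)
  have hys : Integrable (fun y => y * s y) q := hyL.integrable_mul hsL
  have hs0 : ∫ y, s y ∂q = 0 := by
    have := integral_id_gaussianReal (μ := 0) (v := 1)
    rw [← hmap, integral_map hs.aemeasurable (by fun_prop)] at this
    exact this
  obtain ⟨hgi, hgint⟩ := aux_fubini q s hs hsi hys hs0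
  rw [← hgint]
  have hgood : ∀ t, 0 < cdf q t → cdf q t < 1 →
      ∫ y in Ioi t, s y ∂q = gaussianPDFReal 0 1 (s t) := by
    intro t h0 h1
    rw [setIntegral_congr_set (hset t h0 h1), ← aux_gauss_tail, ← hmap,
      setIntegral_map measurableSet_Ioi (by fun_prop) hs.aemeasurable]
  have hnn : ∀ t, 0 ≤ ∫ y in Ioi t, s y ∂q := by
    intro t
    rcases (cdf_nonneg q t).eq_or_lt with h0 | h0
    · have h : q (Iic t) = 0 := by rw [← ofReal_cdf, ← h0]; simp
      have : (Ioi t : Set ℝ) =ᵐ[q] univ := by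
        rw [ae_eq_univ, compl_Ioi]; exact h
      rw [setIntegral_congr_set this, setIntegral_univ, hs0]
    rcases (cdf_le_one q t).eq_or_lt with h1 | h1
    · have h : q (Iic t) = 1 := by rw [← ofReal_cdf, h1]; simp
      have : q (Ioi t) = 0 := by
        rw [← compl_Iic, prob_compl_eq_zero_iff measurableSet_Iic]; exact h
      rw [setIntegral_measure_zero _ this]
    · rw [hgood t h0 h1]; exact gaussianPDFReal_nonneg _ _ _
  set f : ℝ → ℝ := fun x => (q.rnDeriv volume x).toReal with hf
  let u : ℝ → ℝ := fun t => Real.log (gaussianPDFReal 0 1 (s t)) - Real.log (f t)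
  have hu1 : ∀ t, Real.log (gaussianPDFReal 0 1 (s t)) = - Real.log (√(2 * π)) - s t ^ 2 / 2 := by
    intro t
    rw [aux_log_gauss 0 1 one_ne_zero]; simp
  have hu2 : Integrable (fun t => Real.log (gaussianPDFReal 0 1 (s t))) q := by
    simp_rw [hu1]
    exact (integrable_const _).sub (hs2.div_const 2)
  have hui : Integrable u q := hu2.sub hl
  have huc : ∫ t, u t ∂q = - (∫ x, Real.log (f x) ∂q) - Real.log (√(2 * π)) - 1 / 2 := by
    simp only [u]
    rw [integral_sub hu2 hl]
    simp_rw [hu1]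
    rw [integral_sub (integrable_const _) (hs2.div_const 2), integral_div, hs2i]
    simp
    ring
  rw [← huc]
  set c := ∫ t, u t ∂q with hc
  let h : ℝ → ℝ := fun t => Real.exp c * (1 + u t - c)
  have hhi : Integrable h q :=
    (((integrable_const 1).add hui).sub (integrable_const c)).const_mul _
  have hhint : ∫ t, h t ∂q = Real.exp c := by
    have h1 : Integrable (fun t => 1 + u t) q := (integrable_const 1).add hui
    simp only [h]
    rw [integral_const_mul, integral_sub h1 (integrable_const c),
      integral_add (integrable_const 1) hui, ← hc]
    simp
  have hgoodae : ∀ᵐ t ∂(volume : Measure ℝ), f t ≠ 0 → 0 < cdf q t ∧ cdf q t < 1 := by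
    have h1 := aux_cdf_mem q hq0
    rw [← Measure.withDensity_rnDeriv_eq q volume hac,
      ae_withDensity_iff (Measure.measurable_rnDeriv _ _),
      Measure.withDensity_rnDeriv_eq q volume hac] at h1
    filter_upwards [h1] with t ht hft
    apply ht
    intro h0
    apply hft
    simp [hf, h0]
  rw [← hhint, ← integral_rnDeriv_smul hac]
  refine integral_mono_ae ((integrable_rnDeriv_smul_iff hac).2 hhi) hgi ?_
  filter_upwards [hgoodae] with t ht
  change f t * h t ≤ _
  by_cases hft : f t = 0
  · rw [hft, zero_mul]; exact hnn t
  · obtain ⟨h0, h1⟩ := ht hft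
    have hfp : 0 < f t := lt_of_le_of_ne ENNReal.toReal_nonneg (Ne.symm hft)
    rw [hgood t h0 h1]
    have hφ := gaussianPDFReal_pos 0 1 (s t) one_ne_zero
    have e1 : f t * Real.exp (u t) = gaussianPDFReal 0 1 (s t) := by
      simp only [u]
      rw [Real.exp_sub, Real.exp_log hφ, Real.exp_log hfp]
      field_simp
    rw [← e1]
    apply mul_le_mul_of_nonneg_left _ hfp.le
    have e2 : Real.exp (u t) = Real.exp c * Real.exp (u t - c) := by
      rw [← Real.exp_add]; ring_nf
    rw [e2]
    apply mul_le_mul_of_nonneg_left _ (Real.exp_pos c).le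
    linarith [Real.add_one_le_exp (u t - c)]

lemma aux_cost (cpl : Measure (ℝ × ℝ)) [IsProbabilityMeasure cpl] (P Q : Measure ℝ)
    (h1 : cpl.map Prod.fst = P) (h2 : cpl.map Prod.snd = Q)
    (hP : Integrable (fun x => x ^ 2) P) (hQ : Integrable (fun x => x ^ 2) Q)
    (a b σ τ : ℝ) (hσ : 0 < σ) (hτ : 0 < τ)
    (hPm : ∫ x, x ∂P = a) (hQm : ∫ x, x ∂Q = b)
    (hPv : ∫ x, (x - a) ^ 2 ∂P = σ ^ 2) (hQv : ∫ x, (x - b) ^ 2 ∂Q = τ ^ 2) :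
    ∫⁻ xy, ENNReal.ofReal ((xy.1 - xy.2) ^ 2) ∂cpl =
      ENNReal.ofReal ((a - b) ^ 2 + σ ^ 2 + τ ^ 2 - 2 * ∫ xy, (xy.1 - a) * (xy.2 - b) ∂cpl) ∧
    ∫ xy, (xy.1 - a) * (xy.2 - b) ∂cpl ≤ σ * τ := by
  subst h1 h2
  have i1 : Integrable (fun w : ℝ × ℝ => w.1 ^ 2) cpl := hP.comp_measurable measurable_fst
  have i2 : Integrable (fun w : ℝ × ℝ => w.2 ^ 2) cpl := hQ.comp_measurable measurable_snd
  rw [integral_map measurable_fst.aemeasurable (by fun_prop)] at hPm hPv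
  rw [integral_map measurable_snd.aemeasurable (by fun_prop)] at hQm hQv
  have l1 : MemLp (fun w : ℝ × ℝ => w.1) 2 cpl :=
    (memLp_two_iff_integrable_sq measurable_fst.aestronglyMeasurable).2 i1
  have l2 : MemLp (fun w : ℝ × ℝ => w.2) 2 cpl :=
    (memLp_two_iff_integrable_sq measurable_snd.aestronglyMeasurable).2 i2
  have m1 : MemLp (fun w : ℝ × ℝ => w.1 - a) 2 cpl := l1.sub (memLp_const a)
  have m2 : MemLp (fun w : ℝ × ℝ => w.2 - b) 2 cpl := l2.sub (memLp_const b)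
  have j1 : Integrable (fun w : ℝ × ℝ => w.1 - a) cpl := m1.integrable (by norm_num)
  have j2 : Integrable (fun w : ℝ × ℝ => w.2 - b) cpl := m2.integrable (by norm_num)
  have k1 : Integrable (fun w : ℝ × ℝ => (w.1 - a) ^ 2) cpl := m1.integrable_sq
  have k2 : Integrable (fun w : ℝ × ℝ => (w.2 - b) ^ 2) cpl := m2.integrable_sq
  have k3 : Integrable (fun w : ℝ × ℝ => (w.1 - a) * (w.2 - b)) cpl := m1.integrable_mul m2
  have z1 : ∫ w : ℝ × ℝ, w.1 - a ∂cpl = 0 := by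
    rw [integral_sub (l1.integrable (by norm_num)) (integrable_const _), hPm]; simp
  have z2 : ∫ w : ℝ × ℝ, w.2 - b ∂cpl = 0 := by
    rw [integral_sub (l2.integrable (by norm_num)) (integrable_const _), hQm]; simp
  constructor
  · have n1 : Integrable (fun w : ℝ × ℝ => (w.1 - w.2) ^ 2) cpl := (l1.sub l2).integrable_sq
    rw [← ofReal_integral_eq_lintegral_ofReal n1
      (Filter.Eventually.of_forall fun w => sq_nonneg _)]
    congr 1
    have e : ∀ w : ℝ × ℝ, (w.1 - w.2) ^ 2 = ((((a - b) ^ 2 + (2 * (a - b)) * (w.1 - a))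
        - (2 * (a - b)) * (w.2 - b)) + (w.1 - a) ^ 2 + (w.2 - b) ^ 2)
        - 2 * ((w.1 - a) * (w.2 - b)) := by intro w; ring
    simp_rw [e]
    rw [integral_sub (by fun_prop) (by fun_prop), integral_add (by fun_prop) (by fun_prop),
      integral_add (by fun_prop) (by fun_prop), integral_sub (by fun_prop) (by fun_prop),
      integral_add (by fun_prop) (by fun_prop), integral_const_mul, integral_const_mul,
      integral_const_mul, z1, z2, hPv, hQv]
    simp
  · have : ∫ w : ℝ × ℝ, (w.1 - a) * (w.2 - b) ∂cpl ≤
        ∫ w : ℝ × ℝ, (τ / (2 * σ)) * (w.1 - a) ^ 2 + (σ / (2 * τ)) * (w.2 - b) ^ 2 ∂cpl := by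
      refine integral_mono k3 (by fun_prop) fun w => ?_
      simp only
      have : (τ / (2 * σ)) * (w.1 - a) ^ 2 + (σ / (2 * τ)) * (w.2 - b) ^ 2
          - (w.1 - a) * (w.2 - b) = (τ * (w.1 - a) - σ * (w.2 - b)) ^ 2 / (2 * σ * τ) := by
        field_simp; ring
      have h0 : 0 ≤ (τ * (w.1 - a) - σ * (w.2 - b)) ^ 2 / (2 * σ * τ) := by positivity
      linarith
    rw [integral_add (by fun_prop) (by fun_prop), integral_const_mul, integral_const_mul,
      hPv, hQv] at this
    refine this.trans (le_of_eq ?_)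
    field_simp; ring

lemma aux_KL (q : Measure ℝ) [IsProbabilityMeasure q] (hac : q ≪ volume)
    (hm2 : Integrable (fun x => x ^ 2) q) (m V : ℝ) (hmean : ∫ x, x ∂q = m)
    (hvar : ∫ x, (x - m) ^ 2 ∂q = V) (a : ℝ) (v : ℝ≥0) (hv : v ≠ 0) :
    (Integrable (fun x => Real.log (q.rnDeriv (gaussianReal a v) x).toReal) q ↔
      Integrable (fun x => Real.log (q.rnDeriv volume x).toReal) q) ∧
    (Integrable (fun x => Real.log (q.rnDeriv volume x).toReal) q →
      ∫ x, Real.log (q.rnDeriv (gaussianReal a v) x).toReal ∂q =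
      (∫ x, Real.log (q.rnDeriv volume x).toReal ∂q) + Real.log (√(2 * π * v))
        + (V + (m - a) ^ 2) / (2 * v)) := by
  have hpac : q ≪ gaussianReal a v := hac.trans (gaussianReal_absolutelyContinuous' a hv)
  have hlog : (fun x => Real.log (q.rnDeriv (gaussianReal a v) x).toReal) =ᵐ[q]
      fun x => Real.log (q.rnDeriv volume x).toReal
        + (Real.log (√(2 * π * v)) + (x - a) ^ 2 / (2 * v)) := by
    filter_upwards [hac (Measure.rnDeriv_mul_rnDeriv (κ := volume) hpac),
      hac (rnDeriv_gaussianReal a v), Measure.rnDeriv_pos hpac,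
      hpac (Measure.rnDeriv_lt_top q (gaussianReal a v))] with x h1 h2 h3 h4
    rw [← h1, Pi.mul_apply, h2, ENNReal.toReal_mul, toReal_gaussianPDF,
      Real.log_mul (ENNReal.toReal_pos h3.ne' h4.ne).ne' (gaussianPDFReal_pos a v x hv).ne',
      aux_log_gauss a v hv]
    ring
  have l1 : MemLp (fun x : ℝ => x) 2 q :=
    (memLp_two_iff_integrable_sq measurable_id.aestronglyMeasurable).2 hm2
  have hx : Integrable (fun x : ℝ => x) q := l1.integrable (by norm_num)
  have hsq : Integrable (fun x : ℝ => (x - a) ^ 2) q := (l1.sub (memLp_const a)).integrable_sq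
  have hsq' : Integrable (fun x : ℝ => (x - m) ^ 2) q := (l1.sub (memLp_const m)).integrable_sq
  have hxm : Integrable (fun x : ℝ => x - m) q := hx.sub (integrable_const m)
  have hr : Integrable (fun x : ℝ => Real.log (√(2 * π * v)) + (x - a) ^ 2 / (2 * v)) q :=
    (integrable_const _).add (hsq.div_const _)
  have hva : ∫ x, (x - a) ^ 2 ∂q = V + (m - a) ^ 2 := by
    have e : ∀ x : ℝ, (x - a) ^ 2 = ((x - m) ^ 2 + (2 * (m - a)) * (x - m)) + (m - a) ^ 2 := by
      intro x; ring
    rw [integral_congr_ae (Filter.Eventually.of_forall e)]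
    rw [integral_add (by fun_prop) (by fun_prop), integral_add (by fun_prop) (by fun_prop),
      integral_const_mul, hvar, integral_sub hx (by fun_prop), hmean]
    simp
  constructor
  · rw [integrable_congr hlog]
    exact integrable_add_iff_integrable_left hr
  · intro hl
    rw [integral_congr_ae hlog, integral_add hl hr,
      integral_add (by fun_prop) (hsq.div_const _), integral_div, hva]
    simp
    ring

lemma aux_gauss_ent (m : ℝ) (v : ℝ≥0) (hv : v ≠ 0) :
    Integrable (fun x => Real.log ((gaussianReal m v).rnDeriv volume x).toReal) (gaussianReal m v) ∧
    ∫ x, Real.log ((gaussianReal m v).rnDeriv volume x).toReal ∂(gaussianReal m v) =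
      - Real.log (√(2 * π * v)) - 1 / 2 := by
  have hv' : (v : ℝ) ≠ 0 := by exact_mod_cast hv
  have h : (fun x => Real.log ((gaussianReal m v).rnDeriv volume x).toReal) =ᵐ[gaussianReal m v]
      fun x => - Real.log (√(2 * π * v)) - (x - m) ^ 2 / (2 * v) := by
    filter_upwards [(gaussianReal_absolutelyContinuous m hv) (rnDeriv_gaussianReal m v)] with x hx
    rw [hx, toReal_gaussianPDF, aux_log_gauss m v hv]
  have hsq : Integrable (fun x : ℝ => (x - m) ^ 2) (gaussianReal m v) :=
    ((memLp_id_gaussianReal (μ := m) (v := v) 2).sub (memLp_const m)).integrable_sq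
  constructor
  · rw [integrable_congr h]
    exact (integrable_const _).sub (hsq.div_const _)
  · rw [integral_congr_ae h, integral_sub (integrable_const _) (hsq.div_const _), integral_div,
      (aux_gauss_sq m v).2]
    simp
    field_simp

lemma aux_gauss_eq (m s : ℝ) : gauss m s = gaussianReal m (NNReal.mk (s ^ 2) (sq_nonneg s)) := rfl

lemma aux_final (μX σX : ℝ) (hσX : 0 < σX) (q : Measure ℝ) (hq : IsProbabilityMeasure q)
    (hm2 : Integrable (fun x => x ^ 2) q) (μhat σhat : ℝ) (hmean : ∫ x, x ∂q = μhat)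
    (hσhat : 0 < σhat) (hvar : ∫ x, (x - μhat) ^ 2 ∂q = σhat ^ 2)
    (cpl : Measure (ℝ × ℝ)) (hc : IsProbabilityMeasure cpl) (h1 : cpl.map Prod.fst = gauss μX σX)
    (h2 : cpl.map Prod.snd = q) (E : ℝ)
    (hE : σX * σhat * E ≤ ∫ xy, (xy.1 - μX) * (xy.2 - μhat) ∂cpl) :
    W2sq (gauss μX σX) q - W2sq (gauss μX σX) (gauss μhat σhat) ≤
      ENNReal.ofReal (2 * σX * σhat * (1 - E)) := by
  have gm : ∀ m s : ℝ, ∫ x, x ∂(gauss m s) = m := fun m s => integral_id_gaussianReal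
  have gv : ∀ m s : ℝ, ∫ x, (x - m) ^ 2 ∂(gauss m s) = s ^ 2 := fun m s => (aux_gauss_sq m _).2
  have gi : ∀ m s : ℝ, Integrable (fun x => x ^ 2) (gauss m s) := fun m s => (aux_gauss_sq m _).1
  have hup : W2sq (gauss μX σX) q ≤
      ENNReal.ofReal ((μX - μhat) ^ 2 + (σX - σhat) ^ 2 + 2 * σX * σhat * (1 - E)) := by
    refine (iInf₂_le_of_le cpl hc (iInf₂_le_of_le h1 h2 le_rfl)).trans ?_
    rw [(aux_cost cpl _ _ h1 h2 (gi _ _) hm2 μX μhat σX σhat hσX hσhat (gm _ _) hmean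
      (gv _ _) hvar).1]
    apply ENNReal.ofReal_le_ofReal
    nlinarith
  have hlo : ENNReal.ofReal ((μX - μhat) ^ 2 + (σX - σhat) ^ 2) ≤
      W2sq (gauss μX σX) (gauss μhat σhat) := by
    refine le_iInf fun c' => le_iInf fun hc' => le_iInf fun h1' => le_iInf fun h2' => ?_
    obtain ⟨e1, e2⟩ := aux_cost c' _ _ h1' h2' (gi _ _) (gi _ _) μX μhat σX σhat hσX hσhat
      (gm _ _) (gm _ _) (gv _ _) (gv _ _)
    rw [e1]
    apply ENNReal.ofReal_le_ofReal
    nlinarith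
  refine (tsub_le_tsub hup hlo).trans ?_
  rw [← ENNReal.ofReal_sub _ (by positivity)]
  apply ENNReal.ofReal_le_ofReal
  linarith

/-- Quantitative comparison of Wasserstein and KL gaps under Gaussianization. -/
theorem stmt18 (μX σX : ℝ) (hσX : 0 < σX) (q : Measure ℝ) (hq : IsProbabilityMeasure q)
    (hm2 : Integrable (fun x => x ^ 2) q) (μhat σhat : ℝ) (hmean : ∫ x, x ∂q = μhat)
    (hσhat : 0 < σhat) (hvar : ∫ x, (x - μhat) ^ 2 ∂q = σhat ^ 2) :
    W2sq (gauss μX σX) q - W2sq (gauss μX σX) (gauss μhat σhat) ≤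
      ENNReal.ofReal (2 * σX * σhat *
        (1 - expNeg (KLD q (gauss μX σX) - KLD (gauss μhat σhat) (gauss μX σX)))) := by
  have hvX : (NNReal.mk (σX ^ 2) (sq_nonneg σX)) ≠ 0 := by
    intro h; have := congrArg NNReal.toReal h; simp at this; exact hσX.ne' this
  have hvh : (NNReal.mk (σhat ^ 2) (sq_nonneg σhat)) ≠ 0 := by
    intro h; have := congrArg NNReal.toReal h; simp at this; exact hσhat.ne' this
  have hpX : IsProbabilityMeasure (gauss μX σX) := by rw [aux_gauss_eq]; infer_instance
  have hpG : IsProbabilityMeasure (gauss μhat σhat) := by rw [aux_gauss_eq]; infer_instance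
  have hGac : gauss μhat σhat ≪ volume := gaussianReal_absolutelyContinuous μhat hvh
  have hXac : gauss μX σX ≪ volume := gaussianReal_absolutelyContinuous μX hvX
  have hXac' : volume ≪ gauss μX σX := gaussianReal_absolutelyContinuous' μX hvX
  obtain ⟨g1, g2⟩ := aux_KL (gauss μhat σhat) hGac (aux_gauss_sq _ _).1 μhat (σhat ^ 2)
    integral_id_gaussianReal (aux_gauss_sq _ _).2 μX _ hvX
  obtain ⟨ge1, ge2⟩ := aux_gauss_ent μhat _ hvh
  have hKG : KLD (gauss μhat σhat) (gauss μX σX) =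
      ENNReal.ofReal (∫ x, Real.log ((gauss μhat σhat).rnDeriv (gauss μX σX) x).toReal
        ∂(gauss μhat σhat)) := by
    unfold KLD
    rw [if_pos ⟨hGac.trans hXac', g1.2 ge1⟩]
  have hlogs : ∀ s : ℝ, 0 < s → Real.log (√(2 * π * s ^ 2)) = Real.log (√(2 * π)) + Real.log s := by
    intro s hs
    rw [Real.sqrt_mul (by positivity), Real.sqrt_sq hs.le, Real.log_mul (by positivity) hs.ne']
  have hGval := g2 ge1
  change _ = (∫ x, Real.log ((gaussianReal μhat (NNReal.mk (σhat ^ 2) (sq_nonneg σhat))).rnDeriv volume x).toReal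
    ∂(gaussianReal μhat (NNReal.mk (σhat ^ 2) (sq_nonneg σhat)))) + _ + _ at hGval
  rw [ge2] at hGval
  simp only [NNReal.coe_mk] at hGval
  rw [hlogs _ hσX, hlogs _ hσhat] at hGval
  by_cases hcase : q ≪ gauss μX σX ∧
      Integrable (fun x => Real.log (q.rnDeriv (gauss μX σX) x).toReal) q
  · have hqac : q ≪ volume := hcase.1.trans hXac
    obtain ⟨k1, k2⟩ := aux_KL q hqac hm2 μhat (σhat ^ 2) hmean hvar μX _ hvX
    have hl := k1.1 hcase.2
    have hqval := k2 hl
    simp only [NNReal.coe_mk] at hqval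
    rw [hlogs _ hσX] at hqval
    have hKq : KLD q (gauss μX σX) =
        ENNReal.ofReal (∫ x, Real.log (q.rnDeriv (gauss μX σX) x).toReal ∂q) := by
      unfold KLD
      rw [if_pos hcase]
    rw [hKq, hKG]
    change (∫ x, Real.log (q.rnDeriv (gauss μX σX) x).toReal ∂q) = _ at hqval
    change (∫ x, Real.log ((gauss μhat σhat).rnDeriv (gauss μX σX) x).toReal ∂(gauss μhat σhat))
      = _ at hGval
    set A := ∫ x, Real.log (q.rnDeriv (gauss μX σX) x).toReal ∂q with hA
    set B := ∫ x, Real.log ((gauss μhat σhat).rnDeriv (gauss μX σX) x).toReal ∂(gauss μhat σhat)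
      with hB
    have hB0 : 0 ≤ B := by
      have h := Real.log_le_sub_one_of_pos (x := (σhat / σX) ^ 2) (by positivity)
      rw [Real.log_pow, Real.log_div hσhat.ne' hσX.ne'] at h
      have h3 : (σhat ^ 2 + (μhat - μX) ^ 2) / (2 * σX ^ 2) =
        (σhat / σX) ^ 2 / 2 + (μhat - μX) ^ 2 / (2 * σX ^ 2) := by field_simp
      have h4 : 0 ≤ (μhat - μX) ^ 2 / (2 * σX ^ 2) := by positivity
      push_cast at h
      linarith
    obtain ⟨s, hs, hmap, hexp⟩ := aux_main q hqac hm2 hl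
    have hexpNeg : expNeg (ENNReal.ofReal A - ENNReal.ofReal B) ≤ Real.exp (-(A - B)) := by
      rw [← ENNReal.ofReal_sub _ hB0]
      unfold expNeg
      rw [if_neg ENNReal.ofReal_ne_top]
      apply Real.exp_le_exp.2
      rw [ENNReal.toReal_ofReal']
      exact neg_le_neg (le_max_left _ _)
    have hmeas : Measurable (fun y : ℝ => (μX + σX * s y, y)) := by fun_prop
    have hs0 : ∫ y, s y ∂q = 0 := by
      have := integral_id_gaussianReal (μ := 0) (v := 1)
      rw [← hmap, integral_map hs.aemeasurable (by fun_prop)] at this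
      exact this
    have hs2 : Integrable (fun y => s y ^ 2) q := by
      have := (aux_gauss_sq 0 1).1
      rw [← hmap] at this
      exact this.comp_measurable hs
    have hsL : MemLp s 2 q := (memLp_two_iff_integrable_sq hs.aestronglyMeasurable).2 hs2
    have hyL : MemLp (fun y : ℝ => y) 2 q :=
      (memLp_two_iff_integrable_sq measurable_id.aestronglyMeasurable).2 hm2
    have hsi : Integrable s q := hsL.integrable (by norm_num)
    have hys : Integrable (fun y => y * s y) q := hyL.integrable_mul hsL
    refine aux_final μX σX hσX q hq hm2 μhat σhat hmean hσhat hvar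
      (q.map (fun y => (μX + σX * s y, y))) (Measure.isProbabilityMeasure_map hmeas.aemeasurable)
      ?_ ?_ _ ?_
    · rw [Measure.map_map measurable_fst hmeas]
      have : (Prod.fst ∘ fun y : ℝ => (μX + σX * s y, y)) = (μX + ·) ∘ (σX * ·) ∘ s := rfl
      rw [this, ← Measure.map_map (by fun_prop) (by fun_prop),
        ← Measure.map_map (by fun_prop) hs, hmap, gaussianReal_map_const_mul,
        gaussianReal_map_const_add]
      rw [aux_gauss_eq]
      congr 1
      · ring
      · rw [mul_one]
    · rw [Measure.map_map measurable_snd hmeas]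
      exact Measure.map_id
    · rw [integral_map hmeas.aemeasurable (by fun_prop)]
      have e : ∀ y, (μX + σX * s y - μX) * (y - μhat) = σX * (y * s y) - (σX * μhat) * s y := by
        intro y; ring
      simp only [e]
      rw [integral_sub (hys.const_mul _) (hsi.const_mul _), integral_const_mul, integral_const_mul,
        hs0, mul_zero, sub_zero, mul_assoc]
      apply mul_le_mul_of_nonneg_left _ hσX.le
      refine le_trans ?_ hexp
      refine (mul_le_mul_of_nonneg_left hexpNeg hσhat.le).trans (le_of_eq ?_)
      nth_rewrite 1 [← Real.exp_log hσhat]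
      rw [← Real.exp_add]
      congr 1
      rw [hqval, hGval]
      ring
  · have hKq : KLD q (gauss μX σX) = ⊤ := by unfold KLD; rw [if_neg hcase]
    have hz : expNeg (KLD q (gauss μX σX) - KLD (gauss μhat σhat) (gauss μX σX)) = 0 := by
      rw [hKq, hKG, ENNReal.top_sub ENNReal.ofReal_ne_top]
      simp [expNeg]
    rw [hz]
    refine aux_final μX σX hσX q hq hm2 μhat σhat hmean hσhat hvar
      ((gauss μX σX).prod q) inferInstance (by simp) (by simp) 0 ?_
    rw [integral_prod_mul (fun x => x - μX) (fun y => y - μhat)]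
    have : ∫ x, x - μX ∂(gauss μX σX) = 0 := by
      have hi : Integrable (fun x : ℝ => x) (gauss μX σX) :=
        (memLp_id_gaussianReal (μ := μX) 1).integrable (by simp)
      rw [integral_sub hi (integrable_const _)]
      have := integral_id_gaussianReal (μ := μX) (v := (NNReal.mk (σX ^ 2) (sq_nonneg σX)))
      simp [aux_gauss_eq, this]
    rw [this]; simp
end

section
/- Let p_X be the Gaussian distribution N(μ_X, σ_X²) with σ_X > 0, let P ∈ [0,∞), and let p_X̂ be a probability measure on ℝ with finite second moment, mean μ_X̂, and standard deviation σ_X̂, such that W₂²(p_X, p_X̂) ≤ P. For r ∈ [0,∞), define D(r | p_X̂) := inf E[(X̂−Ŷ)²] over joint laws of real random variables (X̂,Ŷ) with X̂ having law p_X̂, Ŷ having finite second moment, and I(X̂;Ŷ) ≤ r. Then for every r ∈ [0,∞), D(r | p_X̂) ≥ sup over α > 0 of (max{σ_X e^{−r} − G(α), 0})² / α², where G(α) := √(σ_X² − α((μ_X−μ_X̂)² + σ_X² + σ_X̂² − P) + α² σ_X̂²) (with the convention √t := 0 for t < 0). -/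
open MeasureTheory ProbabilityTheory Real Set
open scoped ENNReal NNReal

open InformationTheory in
/-- `KLD` agrees with Mathlib's `klDiv` on probability measures. -/
lemma KLD_eq_klDiv {α : Type*} [MeasurableSpace α] (q p : Measure α)
    [IsProbabilityMeasure q] [IsProbabilityMeasure p] : KLD q p = klDiv q p := by
  rw [klDiv_def, KLD]
  simp only [llr_def, probReal_univ, add_sub_cancel_right]
  congr

open InformationTheory in
/-- Donsker-Varadhan (easy half). -/
lemma dv_le {Ω : Type*} [MeasurableSpace Ω] (M N : Measure Ω)
    [IsProbabilityMeasure M] [IsProbabilityMeasure N] (f : Ω → ℝ) (hfm : Measurable f)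
    (hf : Integrable f M) (hexp : ∫⁻ w, ENNReal.ofReal (Real.exp (f w)) ∂N ≤ 1)
    (r : ℝ) (hr : 0 ≤ r) (hkl : klDiv M N ≤ ENNReal.ofReal r) : ∫ w, f w ∂M ≤ r := by
  have hne : klDiv M N ≠ ⊤ := ne_top_of_le_ne_top ENNReal.ofReal_ne_top hkl
  obtain ⟨hac, hint⟩ := klDiv_ne_top_iff.1 hne
  have hexpi : Integrable (fun w => Real.exp (f w)) N := by
    refine ⟨by fun_prop, ?_⟩
    rw [hasFiniteIntegral_iff_ofReal (ae_of_all _ fun w => (Real.exp_pos _).le)]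
    exact hexp.trans_lt ENNReal.one_lt_top
  have hexp1 : ∫ w, Real.exp (f w) ∂N ≤ 1 := by
    rw [integral_eq_lintegral_of_nonneg_ae (ae_of_all _ fun w => (Real.exp_pos _).le)
      (by fun_prop)]
    exact ENNReal.toReal_le_of_le_ofReal zero_le_one (by simpa using hexp)
  have hpos : 0 < ∫ w, Real.exp (f w) ∂N := integral_exp_pos hexpi
  have hlog : Real.log (∫ w, Real.exp (f w) ∂N) ≤ 0 := Real.log_nonpos hpos.le hexp1
  have h1 := integral_llr_tilted_right hac hf hexpi hint
  have hprob : IsProbabilityMeasure (N.tilted f) := isProbabilityMeasure_tilted hexpi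
  have hac' : M ≪ N.tilted f := hac.trans (absolutelyContinuous_tilted hexpi)
  have h2 := integral_llr_add_sub_measure_univ_nonneg hac'
    (integrable_llr_tilted_right hac hf hint hexpi)
  have h3 : (klDiv M N).toReal = ∫ a, llr M N a ∂M :=
    toReal_klDiv_of_measure_eq hac (by simp)
  have h4 : (klDiv M N).toReal ≤ r := ENNReal.toReal_le_of_le_ofReal hr hkl
  simp at h2
  linarith

/-- Minkowski in `L²`. -/
lemma mink {Ω : Type*} [MeasurableSpace Ω] (M : Measure Ω) (A B : Ω → ℝ)
    (hA : MemLp A 2 M) (hB : MemLp B 2 M) :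
    √(∫ w, (A w + B w) ^ 2 ∂M) ≤ √(∫ w, A w ^ 2 ∂M) + √(∫ w, B w ^ 2 ∂M) := by
  have iA := hA.integrable_sq
  have iB := hB.integrable_sq
  have iAB : Integrable (fun w => A w * B w) M := hA.integrable_mul hB
  have hexpand (t : ℝ) : ∫ w, (t * A w + B w) ^ 2 ∂M =
      t ^ 2 * ∫ w, A w ^ 2 ∂M + 2 * t * ∫ w, A w * B w ∂M + ∫ w, B w ^ 2 ∂M := by
    rw [← integral_const_mul, ← integral_const_mul, ← integral_add (by fun_prop) (by fun_prop),
      ← integral_add (by fun_prop) (by fun_prop)]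
    congr 1; ext w; ring
  have hd := discrim_le_zero (a := ∫ w, A w ^ 2 ∂M) (b := 2 * ∫ w, A w * B w ∂M)
    (c := ∫ w, B w ^ 2 ∂M) (fun t => by
      have h := hexpand t
      have h0 : 0 ≤ ∫ w, (t * A w + B w) ^ 2 ∂M := integral_nonneg fun w => sq_nonneg _
      linarith)
  have h1 := hexpand 1
  simp only [one_mul] at h1
  rw [h1]
  have a0 : 0 ≤ ∫ w, A w ^ 2 ∂M := integral_nonneg fun w => sq_nonneg _
  have b0 : 0 ≤ ∫ w, B w ^ 2 ∂M := integral_nonneg fun w => sq_nonneg _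
  have cs : ∫ w, A w * B w ∂M ≤ √(∫ w, A w ^ 2 ∂M) * √(∫ w, B w ^ 2 ∂M) := by
    rw [← Real.sqrt_mul a0]
    apply Real.le_sqrt_of_sq_le
    unfold discrim at hd
    nlinarith
  apply Real.sqrt_le_iff.2
  refine ⟨by positivity, ?_⟩
  nlinarith [Real.sq_sqrt a0, Real.sq_sqrt b0]

/-- Gaussian test-channel integral. -/
lemma gauss_ratio (m : ℝ) {v d : ℝ≥0} (hv : v ≠ 0) (hd : d ≠ 0) (z : ℝ) :
    ∫⁻ x, ENNReal.ofReal (Real.exp (Real.log (gaussianPDFReal z d x)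
      - Real.log (gaussianPDFReal m v x))) ∂(gaussianReal m v) = 1 := by
  rw [gaussianReal_of_var_ne_zero m hv,
    lintegral_withDensity_eq_lintegral_mul _ (measurable_gaussianPDF m v)
      (f := gaussianPDF m v) (g := fun x => ENNReal.ofReal (Real.exp
        (Real.log (gaussianPDFReal z d x) - Real.log (gaussianPDFReal m v x))))
      (((measurable_gaussianPDFReal z d).log.sub
        (measurable_gaussianPDFReal m v).log).exp.ennreal_ofReal)]
  rw [← lintegral_gaussianPDF_eq_one z hd]
  congr 1; ext x
  have p1 := gaussianPDFReal_pos m v x hv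
  have p2 := gaussianPDFReal_pos z d x hd
  simp only [Pi.mul_apply, gaussianPDF]
  rw [← ENNReal.ofReal_mul p1.le, Real.exp_sub, Real.exp_log p1, Real.exp_log p2]
  congr 1; field_simp

lemma log_gaussianPDFReal (m : ℝ) {v : ℝ≥0} (hv : v ≠ 0) (x : ℝ) :
    Real.log (gaussianPDFReal m v x) =
      -(Real.log (2 * π) + Real.log v) / 2 - (x - m) ^ 2 / (2 * v) := by
  have hv' : (0:ℝ) < v := by positivity
  rw [gaussianPDFReal, Real.log_mul (by positivity) (Real.exp_pos _).ne', Real.log_exp,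
    Real.log_inv, Real.log_sqrt (by positivity), Real.log_mul (by positivity) hv'.ne']
  ring

open InformationTheory in
/-- Gaussian rate-distortion lower bound in abstract form. -/
lemma gauss_rd {Ω : Type*} [MeasurableSpace Ω] (M N : Measure Ω)
    [IsProbabilityMeasure M] [IsProbabilityMeasure N] (X Z : Ω → ℝ)
    (hXm : Measurable X) (hZm : Measurable Z) (m σ : ℝ) (hσ : 0 < σ)
    (hX : MemLp X 2 M) (hZ : MemLp Z 2 M)
    (hvar : ∫ w, (X w - m) ^ 2 ∂M = σ ^ 2)
    (hN : ∀ F : ℝ × ℝ → ℝ≥0∞, Measurable F → (∀ z, ∫⁻ x, F (z, x) ∂(gauss m σ) = 1) →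
      ∫⁻ w, F (Z w, X w) ∂N = 1)
    (r : ℝ) (hr : 0 ≤ r) (hkl : klDiv M N ≤ ENNReal.ofReal r) :
    σ * Real.exp (-r) ≤ √(∫ w, (X w - Z w) ^ 2 ∂M) := by
  set E := ∫ w, (X w - Z w) ^ 2 ∂M with hE
  have hE0 : 0 ≤ E := integral_nonneg fun w => sq_nonneg _
  set v : ℝ≥0 := ⟨σ ^ 2, sq_nonneg σ⟩ with hvdef
  have hvv : (v : ℝ) = σ ^ 2 := rfl
  have hv : v ≠ 0 := by
    intro h; have : (v : ℝ) = 0 := by rw [h]; rfl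
    rw [hvv] at this; exact (pow_pos hσ 2).ne' this
  have key (D : ℝ) (hD : E < D) : σ ^ 2 * Real.exp (-(2 * r)) ≤ D := by
    have hD0 : 0 < D := hE0.trans_lt hD
    obtain ⟨d, rfl⟩ : ∃ d : ℝ≥0, (d : ℝ) = D := ⟨⟨D, hD0.le⟩, rfl⟩
    have hd : d ≠ 0 := by rintro rfl; simp at hD0
    set F : ℝ × ℝ → ℝ := fun p => Real.log (gaussianPDFReal p.1 d p.2)
      - Real.log (gaussianPDFReal m v p.2) with hF
    have hFeq : F = fun p => -(Real.log (2 * π) + Real.log d) / 2 - (p.2 - p.1) ^ 2 / (2 * d)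
      - (-(Real.log (2 * π) + Real.log v) / 2 - (p.2 - m) ^ 2 / (2 * v)) := by
      ext p; simp only [hF]; rw [log_gaussianPDFReal _ hd, log_gaussianPDFReal _ hv]
    have hFm : Measurable F := by rw [hFeq]; fun_prop
    have i1 : Integrable (fun w => (X w - Z w) ^ 2) M := (hX.sub hZ).integrable_sq
    have i2 : Integrable (fun w => (X w - m) ^ 2) M := (hX.sub (memLp_const m)).integrable_sq
    have hfF : (fun w => F (Z w, X w)) = fun w => (Real.log v - Real.log d) / 2
        - (2 * d : ℝ)⁻¹ * (X w - Z w) ^ 2 + (2 * v : ℝ)⁻¹ * (X w - m) ^ 2 := by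
      ext w; rw [hFeq]; simp only; ring
    have hint : Integrable (fun w => F (Z w, X w)) M := by
      rw [hfF]
      exact ((integrable_const _).sub (i1.const_mul _)).add (i2.const_mul _)
    have hval : ∫ w, F (Z w, X w) ∂M = (Real.log v - Real.log d) / 2
        - (2 * d : ℝ)⁻¹ * E + (2 * v : ℝ)⁻¹ * σ ^ 2 := by
      have j1 : Integrable (fun w => (2 * d : ℝ)⁻¹ * (X w - Z w) ^ 2) M := i1.const_mul _
      have j0 : Integrable (fun w => (Real.log v - Real.log d) / 2
        - (2 * d : ℝ)⁻¹ * (X w - Z w) ^ 2) M := (integrable_const _).sub j1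
      rw [hfF, integral_add j0 (i2.const_mul _),
        integral_sub (integrable_const _) j1, integral_const_mul,
        integral_const_mul, hvar, ← hE]
      simp
    have hb := dv_le M N (fun w => F (Z w, X w)) (hFm.comp (hZm.prodMk hXm)) hint (by
      have hmm : Measurable (fun p => ENNReal.ofReal (Real.exp (F p))) := by fun_prop
      exact (hN _ hmm fun z => gauss_ratio m hv hd z).le) r hr hkl
    rw [hval, hvv] at hb
    have e1 : (2 * d : ℝ)⁻¹ * E ≤ 1 / 2 := by
      rw [inv_mul_le_iff₀ (by positivity)]; linarith
    have e2 : (2 * σ ^ 2 : ℝ)⁻¹ * σ ^ 2 = 1 / 2 := by field_simp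
    rw [e2] at hb
    have e3 : Real.log (σ ^ 2) - 2 * r ≤ Real.log d := by linarith
    have := Real.exp_le_exp.2 e3
    rw [Real.exp_sub, Real.exp_log (by positivity), Real.exp_log hD0] at this
    rw [Real.exp_neg]; exact this
  have h := le_of_forall_gt_imp_ge_of_dense key
  apply Real.le_sqrt_of_sq_le
  calc (σ * Real.exp (-r)) ^ 2 = σ ^ 2 * Real.exp (-(2 * r)) := by
        rw [mul_pow, ← Real.exp_nat_mul]; congr 2; push_cast; ring
    _ ≤ E := h

/-- Second-moment computation for the affine residual. -/
lemma residual_le {Ω : Type*} [MeasurableSpace Ω] (M : Measure Ω) [IsProbabilityMeasure M]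
    (X Xh : Ω → ℝ) (hX : MemLp X 2 M) (hXh : MemLp Xh 2 M) (m s mh sh P α : ℝ) (hα : 0 < α)
    (eX : ∫ w, X w ∂M = m) (eXh : ∫ w, Xh w ∂M = mh)
    (vX : ∫ w, (X w - m) ^ 2 ∂M = s ^ 2) (vXh : ∫ w, (Xh w - mh) ^ 2 ∂M = sh ^ 2)
    (hP : ∫ w, (X w - Xh w) ^ 2 ∂M ≤ P) :
    ∫ w, ((X w - m) - α * (Xh w - mh)) ^ 2 ∂M ≤
      s ^ 2 - α * ((m - mh) ^ 2 + s ^ 2 + sh ^ 2 - P) + α ^ 2 * sh ^ 2 := by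
  have hA : MemLp (fun w => X w - m) 2 M := hX.sub (memLp_const m)
  have hB : MemLp (fun w => Xh w - mh) 2 M := hXh.sub (memLp_const mh)
  have iA := hA.integrable_sq
  have iB := hB.integrable_sq
  have iAB : Integrable (fun w => (X w - m) * (Xh w - mh)) M := hA.integrable_mul hB
  have iX : Integrable X M := hX.integrable (by norm_num)
  have iXh : Integrable Xh M := hXh.integrable (by norm_num)
  set C := ∫ w, (X w - m) * (Xh w - mh) ∂M with hC
  have h1 : ∫ w, ((X w - m) - α * (Xh w - mh)) ^ 2 ∂M = s ^ 2 - 2 * α * C + α ^ 2 * sh ^ 2 := by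
    have k1 : Integrable (fun w => (X w - m) ^ 2 - 2 * α * ((X w - m) * (Xh w - mh))) M :=
      iA.sub (iAB.const_mul _)
    rw [← vX, ← vXh, hC, ← integral_const_mul, ← integral_const_mul,
      ← integral_sub iA (iAB.const_mul _), ← integral_add k1 (iB.const_mul _)]
    congr 1; ext w; ring
  have h0 : ∫ w, (X w - Xh w) ∂M = m - mh := by rw [integral_sub iX iXh, eX, eXh]
  have h2 : ∫ w, (X w - Xh w) ^ 2 ∂M = s ^ 2 - 2 * C + sh ^ 2 + (m - mh) ^ 2 := by
    have h3 : ∫ w, ((X w - m) ^ 2 - 2 * ((X w - m) * (Xh w - mh)) + (Xh w - mh) ^ 2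
        + 2 * (m - mh) * (X w - Xh w) + (- (m - mh) ^ 2)) ∂M
        = s ^ 2 - 2 * C + sh ^ 2 + 2 * (m - mh) * (m - mh) + (- (m - mh) ^ 2) := by
      have k1 : Integrable (fun w => (X w - m) ^ 2 - 2 * ((X w - m) * (Xh w - mh))) M :=
        iA.sub (iAB.const_mul _)
      have k2 : Integrable (fun w => (X w - m) ^ 2 - 2 * ((X w - m) * (Xh w - mh))
        + (Xh w - mh) ^ 2) M := k1.add iB
      have k3 : Integrable (fun w => 2 * (m - mh) * (X w - Xh w)) M := (iX.sub iXh).const_mul _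
      have k4 : Integrable (fun w => (X w - m) ^ 2 - 2 * ((X w - m) * (Xh w - mh))
        + (Xh w - mh) ^ 2 + 2 * (m - mh) * (X w - Xh w)) M := k2.add k3
      rw [integral_add k4 (integrable_const _), integral_add k2 k3, integral_add k1 iB,
        integral_sub iA (iAB.const_mul _), integral_const_mul, integral_const_mul, h0, vX, vXh]
      simp [hC]
    calc _ = _ := by congr 1; ext w; ring
      _ = _ := h3
      _ = _ := by ring
  rw [h1]
  rw [h2] at hP
  nlinarith

/-- The bound for one pair of couplings. -/
lemma bound_of_couplings (μX σX : ℝ) (hσX : 0 < σX)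
    (q : Measure ℝ) [IsProbabilityMeasure q] (hm2 : Integrable (fun x => x ^ 2) q)
    (μhat σhat : ℝ) (hmean : ∫ x, x ∂q = μhat)
    (hvar : ∫ x, (x - μhat) ^ 2 ∂q = σhat ^ 2)
    (r : ℝ) (hr : 0 ≤ r) (P : ℝ) (hP : 0 ≤ P)
    (ρ : Measure (ℝ × ℝ)) [IsProbabilityMeasure ρ] (hρ1 : ρ.map Prod.fst = gauss μX σX)
    (hρ2 : ρ.map Prod.snd = q)
    (hρ : ∫⁻ xy, ENNReal.ofReal ((xy.1 - xy.2) ^ 2) ∂ρ ≤ ENNReal.ofReal P)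
    (cpl : Measure (ℝ × ℝ)) [IsProbabilityMeasure cpl] (hc1 : cpl.map Prod.fst = q)
    (hc2 : Integrable (fun w : ℝ × ℝ => w.2 ^ 2) cpl)
    (hI : mutInfo cpl Prod.fst Prod.snd ≤ ENNReal.ofReal r) (α : ℝ) (hα : 0 < α) :
    σX * Real.exp (-r) ≤
      √(σX ^ 2 - α * ((μX - μhat) ^ 2 + σX ^ 2 + σhat ^ 2 - P) + α ^ 2 * σhat ^ 2)
      + α * √(∫ w, (w.1 - w.2) ^ 2 ∂cpl) := by
  set ρ' : Measure (ℝ × ℝ) := ρ.map Prod.swap with hρ'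
  have : IsProbabilityMeasure ρ' := Measure.isProbabilityMeasure_map (by fun_prop)
  have hf : ρ'.fst = q := by
    rw [Measure.fst, hρ', Measure.map_map (by fun_prop) (by fun_prop), ← hρ2]; rfl
  have hs : ρ'.map Prod.snd = gauss μX σX := by
    rw [hρ', Measure.map_map (by fun_prop) (by fun_prop), ← hρ1]; rfl
  set κ : Kernel ℝ ℝ := ρ'.condKernel with hκ
  have hdis : q ⊗ₘ κ = ρ' := by rw [← hf]; exact ρ'.disintegrate _
  set K : Kernel (ℝ × ℝ) ℝ := κ.comap Prod.fst measurable_fst with hK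
  set pY : Measure ℝ := cpl.map Prod.snd with hpY
  have : IsProbabilityMeasure pY := Measure.isProbabilityMeasure_map (by fun_prop)
  set M := cpl ⊗ₘ K with hM
  set N := (q.prod pY) ⊗ₘ K with hN
  have hkl : InformationTheory.klDiv M N ≤ ENNReal.ofReal r := by
    rw [hM, hN, InformationTheory.klDiv_compProd_left, ← KLD_eq_klDiv]
    have h := hI
    simp only [mutInfo, Prod.mk.eta, hc1] at h
    rwa [show (fun ω : ℝ × ℝ => ω) = id from rfl, Measure.map_id] at h
  -- lintegrals
  have hM1 : M.map Prod.fst = cpl := Measure.fst_compProd cpl K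
  have hM2 : M.map (fun w => (w.1.1, w.2)) = ρ' := by
    ext s hs
    have hmeas : Measurable (fun w : (ℝ × ℝ) × ℝ => (w.1.1, w.2)) := by fun_prop
    rw [Measure.map_apply hmeas hs, ← hdis, Measure.compProd_apply hs, ← hc1,
      lintegral_map (Kernel.measurable_kernel_prodMk_left hs) measurable_fst,
      hM, Measure.compProd_apply (hmeas hs)]
    rfl
  have hN1 : ∀ g : ℝ → ℝ, Measurable g → ∀ F : ℝ × ℝ → ℝ≥0∞, Measurable F →
      (∀ z, ∫⁻ x, F (z, x) ∂(gauss μX σX) = 1) → ∫⁻ w, F (g w.1.2, w.2) ∂N = 1 := by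
    intro g hg F hF h1
    rw [hN, Measure.lintegral_compProd (by fun_prop)]
    rw [lintegral_prod_symm _ (by
      apply Measurable.aemeasurable
      exact Measurable.lintegral_kernel_prod_right'
        (f := fun w : (ℝ × ℝ) × ℝ => F (g w.1.2, w.2)) (by fun_prop))]
    have h2 (y : ℝ) : ∫⁻ x, ∫⁻ b, F (g y, b) ∂(κ x) ∂q = 1 := by
      rw [← h1 (g y), ← hs, lintegral_map (by fun_prop) measurable_snd, ← hdis,
        Measure.lintegral_compProd (by fun_prop)]
    simp only [hK, Kernel.comap_apply]
    simp [h2]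
  -- laws
  have mX : Measurable (fun w : (ℝ × ℝ) × ℝ => w.2) := by fun_prop
  have mXh : Measurable (fun w : (ℝ × ℝ) × ℝ => w.1.1) := by fun_prop
  have mY : Measurable (fun w : (ℝ × ℝ) × ℝ => w.1.2) := by fun_prop
  have lX : M.map (fun w => w.2) = gauss μX σX := by
    rw [← hs, ← hM2, Measure.map_map (by fun_prop) (by fun_prop)]; rfl
  have lXh : M.map (fun w => w.1.1) = q := by
    rw [← hc1, ← hM1, Measure.map_map (by fun_prop) (by fun_prop)]; rfl
  have pX : MemLp (fun w : (ℝ × ℝ) × ℝ => w.2) 2 M := by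
    have h := memLp_id_gaussianReal' (μ := μX) (v := ⟨σX ^ 2, sq_nonneg σX⟩) 2 (by norm_num)
    change MemLp id 2 (gauss μX σX) at h
    rw [← lX] at h
    exact h.comp_of_map mX.aemeasurable
  have pXh : MemLp (fun w : (ℝ × ℝ) × ℝ => w.1.1) 2 M := by
    rw [memLp_two_iff_integrable_sq mXh.aestronglyMeasurable]
    rw [← lXh] at hm2
    exact hm2.comp_measurable mXh
  have pY : MemLp (fun w : (ℝ × ℝ) × ℝ => w.1.2) 2 M := by
    rw [memLp_two_iff_integrable_sq mY.aestronglyMeasurable]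
    rw [← hM1] at hc2
    exact hc2.comp_measurable measurable_fst
  have eX : ∫ w, w.2 ∂M = μX := by
    have h : ∫ x, x ∂(gauss μX σX) = μX := integral_id_gaussianReal
    rw [← lX, integral_map mX.aemeasurable (by fun_prop)] at h
    exact h
  have vX : ∫ w, (w.2 - μX) ^ 2 ∂M = σX ^ 2 := by
    obtain ⟨v, hv⟩ : ∃ v : ℝ≥0, v = ⟨σX ^ 2, sq_nonneg σX⟩ := ⟨_, rfl⟩
    have h := variance_fun_id_gaussianReal (μ := μX) (v := v)
    rw [variance_eq_integral (by fun_prop), integral_id_gaussianReal] at h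
    rw [hv] at h
    change ∫ x, (x - μX) ^ 2 ∂(gauss μX σX) = σX ^ 2 at h
    rw [← lX, integral_map mX.aemeasurable (by fun_prop)] at h
    exact h
  have eXh : ∫ w, w.1.1 ∂M = μhat := by
    rw [← lXh, integral_map mXh.aemeasurable (by fun_prop)] at hmean
    exact hmean
  have vXh : ∫ w, (w.1.1 - μhat) ^ 2 ∂M = σhat ^ 2 := by
    rw [← lXh, integral_map mXh.aemeasurable (by fun_prop)] at hvar
    exact hvar
  have cost : ∫ w, (w.2 - w.1.1) ^ 2 ∂M ≤ P := by
    rw [integral_eq_lintegral_of_nonneg_ae (ae_of_all _ fun w => sq_nonneg _) (by fun_prop)]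
    apply ENNReal.toReal_le_of_le_ofReal hP
    refine le_trans (le_of_eq ?_) hρ
    have e : ∫⁻ p, ENNReal.ofReal ((p.2 - p.1) ^ 2) ∂ρ' =
        ∫⁻ xy, ENNReal.ofReal ((xy.1 - xy.2) ^ 2) ∂ρ := by
      rw [hρ', lintegral_map (by fun_prop) (by fun_prop)]; rfl
    rw [← e, ← hM2, lintegral_map (by fun_prop) (by fun_prop)]
  have dist : ∫ w, (w.1.1 - w.1.2) ^ 2 ∂M = ∫ w, (w.1 - w.2) ^ 2 ∂cpl := by
    rw [← hM1, integral_map (by fun_prop) (by fun_prop)]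
  -- conclusion
  have hres := residual_le M (fun w => w.2) (fun w => w.1.1) pX pXh μX σX μhat σhat P α hα
    eX eXh vX vXh cost
  set c := μX - α * μhat with hc
  have pZ : MemLp (fun w : (ℝ × ℝ) × ℝ => α * w.1.2 + c) 2 M :=
    (pY.const_mul α).add (memLp_const c)
  have h1 := gauss_rd M N (fun w => w.2) (fun w => α * w.1.2 + c) mX (by fun_prop) μX σX hσX
    pX pZ vX (hN1 (fun y => α * y + c) (by fun_prop)) r hr hkl
  have pA : MemLp (fun w : (ℝ × ℝ) × ℝ => (w.2 - μX) - α * (w.1.1 - μhat)) 2 M :=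
    (pX.sub (memLp_const μX)).sub ((pXh.sub (memLp_const μhat)).const_mul α)
  have pB : MemLp (fun w : (ℝ × ℝ) × ℝ => α * (w.1.1 - w.1.2)) 2 M :=
    (pXh.sub pY).const_mul α
  have h2 := mink M _ _ pA pB
  have h3 : ∫ w, (((w.2 - μX) - α * (w.1.1 - μhat)) + α * (w.1.1 - w.1.2)) ^ 2 ∂M
      = ∫ w, (w.2 - (α * w.1.2 + c)) ^ 2 ∂M := by
    congr 1; ext w; rw [hc]; ring
  have h4 : √(∫ w, (α * (w.1.1 - w.1.2)) ^ 2 ∂M) = α * √(∫ w, (w.1 - w.2) ^ 2 ∂cpl) := by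
    simp_rw [mul_pow]
    rw [integral_const_mul, Real.sqrt_mul (sq_nonneg α), Real.sqrt_sq hα.le, dist]
  rw [h3, h4] at h2
  exact h1.trans (h2.trans (by gcongr))

/-- Lower bound on the distortion-rate function `D(r | p_X̂)` of a distribution close to a
Gaussian in squared Wasserstein-2 distance. -/
theorem stmt19 (μX σX : ℝ) (hσX : 0 < σX) (P : ℝ) (hP : 0 ≤ P)
    (q : Measure ℝ) (hq : IsProbabilityMeasure q) (hm2 : Integrable (fun x => x ^ 2) q)
    (μhat σhat : ℝ) (hmean : ∫ x, x ∂q = μhat) (hσhat : 0 ≤ σhat)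
    (hvar : ∫ x, (x - μhat) ^ 2 ∂q = σhat ^ 2)
    (hW2 : W2sq (gauss μX σX) q ≤ ENNReal.ofReal P)
    (r : ℝ) (hr : 0 ≤ r) :
    (⨅ (cpl : Measure (ℝ × ℝ)) (_ : IsProbabilityMeasure cpl ∧ cpl.map Prod.fst = q ∧
        Integrable (fun w : ℝ × ℝ => w.2 ^ 2) cpl ∧
        mutInfo cpl Prod.fst Prod.snd ≤ ENNReal.ofReal r),
      ∫⁻ w, ENNReal.ofReal ((w.1 - w.2) ^ 2) ∂cpl) ≥
    ENNReal.ofReal (sSup ((fun α => max (σX * Real.exp (-r) -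
        Real.sqrt (σX ^ 2 - α * ((μX - μhat) ^ 2 + σX ^ 2 + σhat ^ 2 - P) +
          α ^ 2 * σhat ^ 2)) 0 ^ 2 / α ^ 2)
      '' Set.Ioi 0)) := by
  refine le_iInf₂ fun cpl ⟨hcp, hc1, hc2, hI⟩ => ?_
  have iq : Integrable (fun w : ℝ × ℝ => w.1 ^ 2) cpl := by
    rw [← hc1] at hm2
    exact hm2.comp_measurable measurable_fst
  have p1 : MemLp (fun w : ℝ × ℝ => w.1) 2 cpl :=
    (memLp_two_iff_integrable_sq (by fun_prop)).2 iq
  have p2 : MemLp (fun w : ℝ × ℝ => w.2) 2 cpl :=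
    (memLp_two_iff_integrable_sq (by fun_prop)).2 hc2
  have id : Integrable (fun w : ℝ × ℝ => (w.1 - w.2) ^ 2) cpl := (p1.sub p2).integrable_sq
  rw [← ofReal_integral_eq_lintegral_ofReal id (ae_of_all _ fun w => sq_nonneg _)]
  apply ENNReal.ofReal_le_ofReal
  have hd0 : 0 ≤ ∫ w, (w.1 - w.2) ^ 2 ∂cpl := integral_nonneg fun w => sq_nonneg _
  refine Real.sSup_le ?_ hd0
  rintro _ ⟨α, hα, rfl⟩
  replace hα : 0 < α := hα
  have key : ∀ P' ∈ Set.Ioi P, σX * Real.exp (-r) ≤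
      √(σX ^ 2 - α * ((μX - μhat) ^ 2 + σX ^ 2 + σhat ^ 2 - P') + α ^ 2 * σhat ^ 2)
      + α * √(∫ w, (w.1 - w.2) ^ 2 ∂cpl) := by
    intro P' hP'
    replace hP' : P < P' := hP'
    have hlt : W2sq (gauss μX σX) q < ENNReal.ofReal P' :=
      hW2.trans_lt ((ENNReal.ofReal_lt_ofReal_iff (hP.trans_lt hP')).2 hP')
    simp only [W2sq, iInf_lt_iff] at hlt
    obtain ⟨ρ, hρp, hρ1, hρ2, hρ⟩ := hlt
    exact bound_of_couplings μX σX hσX q hm2 μhat σhat hmean hvar r hr P' (hP.trans hP'.le)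
      ρ hρ1 hρ2 hρ.le cpl hc1 hc2 hI α hα
  have hlim : σX * Real.exp (-r) ≤
      √(σX ^ 2 - α * ((μX - μhat) ^ 2 + σX ^ 2 + σhat ^ 2 - P) + α ^ 2 * σhat ^ 2)
      + α * √(∫ w, (w.1 - w.2) ^ 2 ∂cpl) := by
    have hcont : Continuous (fun P' : ℝ =>
      √(σX ^ 2 - α * ((μX - μhat) ^ 2 + σX ^ 2 + σhat ^ 2 - P') + α ^ 2 * σhat ^ 2)
      + α * √(∫ w, (w.1 - w.2) ^ 2 ∂cpl)) := by fun_prop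
    refine ge_of_tendsto ((hcont.tendsto P).mono_left nhdsWithin_le_nhds)
      (Filter.eventually_of_mem self_mem_nhdsWithin key)
  have hmax : max (σX * Real.exp (-r) -
      √(σX ^ 2 - α * ((μX - μhat) ^ 2 + σX ^ 2 + σhat ^ 2 - P) + α ^ 2 * σhat ^ 2)) 0
      ≤ α * √(∫ w, (w.1 - w.2) ^ 2 ∂cpl) :=
    max_le (by linarith) (by positivity)
  change _ / α ^ 2 ≤ _
  rw [div_le_iff₀ (by positivity)]
  calc _ ≤ (α * √(∫ w, (w.1 - w.2) ^ 2 ∂cpl)) ^ 2 := by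
        exact pow_le_pow_left₀ (le_max_right _ _) hmax 2
    _ = _ := by rw [mul_pow, Real.sq_sqrt hd0, mul_comm]
end
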